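/- Let g : [0,1]ⁿ → ℂ be bounded measurable and suppose the zero set Z = {k ∈ ℕ₊ⁿ : ∫_{[0,1]ⁿ} g(t) t^k dt = 0} satisfies condition (I). Then ∫ g(t) t^k dt = 0 for all k ∈ ℕ₊ⁿ, and consequently g = 0 almost everywhere. -/

import Mathlib

open scoped ENNReal

/-- The fiber of `E` consisting of multi-indices whose coordinates below `j`
agree with those of `a`. -/
def fiberSet {n : ℕ} (E : Set (Fin n → ℕ)) (j : Fin n) (a : Fin n → ℕ) :
    Set (Fin n → ℕ) :=
  {x ∈ E | ∀ i : Fin n, i < j → x i = a i}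

/-- A set `F` of multi-indices is *thick* in the coordinate `j` if the positive
integers occurring as `j`-th coordinates of elements of `F` have divergent
sum of reciprocals. -/
def ThickAt {n : ℕ} (F : Set (Fin n → ℕ)) (j : Fin n) : Prop :=
  ∑' k : {k : ℕ | 0 < k ∧ ∃ x ∈ F, x j = k}, (1 : ℝ≥0∞) / ((k : ℕ) : ℝ≥0∞) = ⊤

/-- Condition (I): `E` contains a subset `Ê` of positive multi-indices such that the
first coordinates of `Ê` have divergent sum of reciprocals and, for every `j ≥ 1`,
every nonempty fiber of `Ê` obtained by fixing the first `j` coordinates is thick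
in the `(j+1)`-st coordinate. -/
def CondI {n : ℕ} [NeZero n] (E : Set (Fin n → ℕ)) : Prop :=
  ∃ Ehat : Set (Fin n → ℕ), Ehat ⊆ E ∧ (∀ x ∈ Ehat, ∀ i, 0 < x i) ∧
    ThickAt Ehat 0 ∧
    ∀ j : Fin n, 0 < j → ∀ a : Fin n → ℕ,
      (fiberSet Ehat j a).Nonempty → ThickAt (fiberSet Ehat j a) j

open MeasureTheory

/-- If `f` is a uniform limit of functions `p` with `∫ h p = 0`, then `∫ h f = 0`. -/
theorem integral_mul_eq_zero_of_approx {α : Type*} [MeasurableSpace α] {μ : Measure α}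
    {h f : α → ℂ} (hh : Integrable h μ) (hf : Integrable (fun t => h t * f t) μ)
    (happ : ∀ ε : ℝ, 0 < ε → ∃ p : α → ℂ, Integrable (fun t => h t * p t) μ ∧
      ∫ t, h t * p t ∂μ = 0 ∧ ∀ᵐ t ∂μ, ‖f t - p t‖ ≤ ε) :
    ∫ t, h t * f t ∂μ = 0 := by
  have key : ∀ ε : ℝ, 0 < ε → ‖∫ t, h t * f t ∂μ‖ ≤ (∫ t, ‖h t‖ ∂μ) * ε := by
    intro ε hε
    obtain ⟨p, hp, hp0, hfp⟩ := happ ε hε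
    rw [← sub_zero (∫ t, h t * f t ∂μ), ← hp0, ← integral_sub hf hp, ← integral_mul_const]
    refine norm_integral_le_of_norm_le (hh.norm.mul_const ε) ?_
    filter_upwards [hfp] with t ht
    rw [← mul_sub, norm_mul]
    gcongr
  have hlim : Filter.Tendsto (fun ε : ℝ => (∫ t, ‖h t‖ ∂μ) * ε) (nhdsWithin 0 (Set.Ioi 0))
      (nhds 0) := by
    have : Filter.Tendsto (fun ε : ℝ => (∫ t, ‖h t‖ ∂μ) * ε) (nhds 0)
      (nhds ((∫ t, ‖h t‖ ∂μ) * 0)) := Filter.tendsto_id.const_mul _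
    rw [mul_zero] at this
    exact this.mono_left nhdsWithin_le_nhds
  have := ge_of_tendsto hlim (by filter_upwards [self_mem_nhdsWithin] with ε hε using key ε hε)
  simpa using this

/-- A solution of `l R - x R' = c Q` with `R 1 = 0` is bounded on `(0, 1]` by `|c| / l` times
the supremum of `|Q|`. -/
theorem abs_le_of_hasDerivAt_of_abs_le {R R' Q : ℝ → ℝ} {c M : ℝ} {l : ℕ} (hl : 0 < l)
    (hR : ∀ x, HasDerivAt R (R' x) x) (h1 : R 1 = 0)
    (hode : ∀ x, l * R x - x * R' x = c * Q x)
    (hQ : ∀ x ∈ Set.Icc (0 : ℝ) 1, |Q x| ≤ M) {x : ℝ} (hx : x ∈ Set.Ioc (0 : ℝ) 1) :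
    |R x| ≤ |c| * M / l := by
  have hl' : (0 : ℝ) < l := by exact_mod_cast hl
  have hM : 0 ≤ M := (abs_nonneg _).trans (hQ 0 (by simp))
  set D : ℝ := |c| * M / l with hD
  have hDl : D * l = |c| * M := by rw [hD]; field_simp
  have hD0 : 0 ≤ D := by positivity
  have hcQ : ∀ y ∈ Set.Icc (0 : ℝ) 1, |c * Q y| ≤ D * l := by
    intro y hy
    rw [hDl, abs_mul]
    exact mul_le_mul_of_nonneg_left (hQ y hy) (abs_nonneg c)
  have main : ∀ s : ℝ, |s| = 1 → s * R x ≤ D := by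
    intro s hs
    have hderiv : ∀ y : ℝ, 0 < y → HasDerivAt (fun y => (s * R y - D) / y ^ l)
        ((s * R' y * y ^ l - (s * R y - D) * (l * y ^ (l - 1))) / (y ^ l) ^ 2) y := by
      intro y hy
      exact (((hR y).const_mul s).sub_const D).div (hasDerivAt_pow l y) (by positivity)
    have hmono : MonotoneOn (fun y => (s * R y - D) / y ^ l) (Set.Icc x 1) := by
      refine monotoneOn_of_deriv_nonneg (convex_Icc x 1) ?_ ?_ ?_
      · intro y hy
        exact (hderiv y (hx.1.trans_le hy.1)).continuousAt.continuousWithinAt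
      · intro y hy
        rw [interior_Icc] at hy
        exact (hderiv y (hx.1.trans hy.1)).differentiableAt.differentiableWithinAt
      · intro y hy
        rw [interior_Icc] at hy
        have hy0 : 0 < y := hx.1.trans hy.1
        rw [(hderiv y hy0).deriv]
        have hpow : y ^ l = y ^ (l - 1) * y := by rw [← pow_succ, Nat.sub_add_cancel hl]
        have h2 : s * R' y * y ^ l - (s * R y - D) * (l * y ^ (l - 1))
            = y ^ (l - 1) * (D * l - s * (c * Q y)) := by
          rw [hpow, ← hode y]; ring
        rw [h2]
        have h3 : s * (c * Q y) ≤ D * l := by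
          refine (le_abs_self _).trans ?_
          rw [abs_mul, hs, one_mul]
          exact hcQ y ⟨hy0.le, hy.2.le⟩
        have h4 := sub_nonneg.2 h3
        positivity
    have h5 := hmono (Set.left_mem_Icc.2 hx.2) (Set.right_mem_Icc.2 hx.2) hx.2
    simp only [h1, one_pow, mul_zero, zero_sub, div_one] at h5
    have hx0 := hx.1
    rw [div_le_iff₀ (by positivity)] at h5
    have h6 : 0 ≤ D * x ^ l := by positivity
    linarith
  refine abs_le.2 ⟨?_, ?_⟩
  · have := main (-1) (by simp); linarith
  · have := main 1 (by simp); linarith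

/-- von Golitschek's quantitative form of the Müntz approximation: `x ^ q` lies within
`∏ |1 - q / k|` of the span of the monomials `x ^ k`, uniformly on `[0, 1]`. -/
theorem exists_monomial_approx {q : ℕ} (hq : 0 < q) (s : Finset ℕ) (hs : ∀ k ∈ s, 0 < k)
    (hqs : q ∉ s) : ∃ a : ℕ → ℝ, ∀ x ∈ Set.Icc (0 : ℝ) 1,
      |x ^ q + ∑ k ∈ s, a k * x ^ k| ≤ ∏ k ∈ s, |1 - (q : ℝ) / k| := by
  induction s using Finset.induction_on with
  | empty =>
    refine ⟨0, fun x hx => ?_⟩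
    simpa [abs_of_nonneg hx.1] using pow_le_one₀ hx.1 hx.2
  | insert l s hl ih =>
    obtain ⟨a, ha⟩ := ih (fun k hk => hs k (Finset.mem_insert_of_mem hk))
      (fun h => hqs (Finset.mem_insert_of_mem h))
    have hl0 : 0 < l := hs l (Finset.mem_insert_self l s)
    have hl' : (0 : ℝ) < l := by exact_mod_cast hl0
    let b : ℕ → ℝ := fun k => a k * (l - q) / (l - k)
    let B : ℝ := -(1 + ∑ k ∈ s, b k)
    have hne : ∀ k ∈ s, (l : ℝ) - k ≠ 0 := by
      intro k hk h
      have : l = k := by exact_mod_cast sub_eq_zero.1 h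
      exact hl (this ▸ hk)
    have hsum : ∀ x : ℝ, ∑ k ∈ insert l s, Function.update b l B k * x ^ k
        = B * x ^ l + ∑ k ∈ s, b k * x ^ k := by
      intro x
      rw [Finset.sum_insert hl, Function.update_self]
      congr 1
      refine Finset.sum_congr rfl fun k hk => ?_
      rw [Function.update_of_ne (ne_of_mem_of_not_mem hk hl)]
    have hxpow : ∀ (x : ℝ) (k : ℕ), x * (k * x ^ (k - 1)) = k * x ^ k := by
      intro x k
      rcases k with _ | k
      · simp
      · rw [Nat.add_sub_cancel, pow_succ]; ring
    refine ⟨Function.update b l B, fun x hx => ?_⟩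
    rw [hsum, Finset.prod_insert hl]
    rcases hx.1.eq_or_lt with rfl | hx0
    · rw [zero_pow hq.ne', zero_pow hl0.ne', Finset.sum_eq_zero]
      · simp only [mul_zero, add_zero, abs_zero]
        exact mul_nonneg (abs_nonneg _) (Finset.prod_nonneg fun _ _ => abs_nonneg _)
      · intro k hk
        rw [zero_pow (hs k (Finset.mem_insert_of_mem hk)).ne', mul_zero]
    · have hfac : |1 - (q : ℝ) / l| = |(l : ℝ) - q| / l := by
        rw [one_sub_div hl'.ne', abs_div, abs_of_pos hl']
      rw [hfac, div_mul_eq_mul_div]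
      refine abs_le_of_hasDerivAt_of_abs_le
        (R := fun x => x ^ q + (B * x ^ l + ∑ k ∈ s, b k * x ^ k))
        (R' := fun x => q * x ^ (q - 1) + (B * (l * x ^ (l - 1)) +
          ∑ k ∈ s, b k * (k * x ^ (k - 1)))) hl0 ?_ ?_ ?_ ha ⟨hx0, hx.2⟩
      · intro y
        exact (hasDerivAt_pow q y).add (((hasDerivAt_pow l y).const_mul B).add
          (HasDerivAt.fun_sum fun k _ => (hasDerivAt_pow k y).const_mul (b k)))
      · simp [B]
      · intro y
        have h1 : y * ∑ k ∈ s, b k * (k * y ^ (k - 1)) = ∑ k ∈ s, b k * (k * y ^ k) := by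
          rw [Finset.mul_sum]
          refine Finset.sum_congr rfl fun k _ => ?_
          rw [← hxpow]; ring
        have h2 : l * ∑ k ∈ s, b k * y ^ k - ∑ k ∈ s, b k * (k * y ^ k)
            = (l - q) * ∑ k ∈ s, a k * y ^ k := by
          rw [Finset.mul_sum, Finset.mul_sum, ← Finset.sum_sub_distrib]
          refine Finset.sum_congr rfl fun k hk => ?_
          have := hne k hk
          simp only [b]
          field_simp
        simp only [mul_add]
        rw [h1]
        linear_combination h2 - hxpow y q - B * hxpow y l

/-- The approximation half of the Müntz theorem. -/
theorem exists_muntz_approx {S : Set ℕ} (hS : ∀ k ∈ S, 0 < k)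
    (hdiv : ∑' k : S, (1 : ENNReal) / ((k : ℕ) : ENNReal) = ⊤) {q : ℕ} (hq : 0 < q)
    {ε : ℝ} (hε : 0 < ε) :
    ∃ (s : Finset ℕ) (a : ℕ → ℝ), (s : Set ℕ) ⊆ S ∧
      ∀ x ∈ Set.Icc (0 : ℝ) 1, |x ^ q - ∑ k ∈ s, a k * x ^ k| ≤ ε := by
  have hsummable : ¬ Summable (fun k : ℕ => S.indicator (fun k : ℕ => (1 : ℝ) / k) k) := by
    intro hsum
    have h1 := hsum.tsum_ofReal_ne_top
    rw [tsum_subtype S (fun k : ℕ => (1 : ENNReal) / (k : ENNReal))] at hdiv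
    apply h1
    rw [← hdiv]
    refine tsum_congr fun k => ?_
    by_cases hk : k ∈ S
    · have : (0 : ℝ) < k := by exact_mod_cast hS k hk
      simp only [Set.indicator_of_mem hk]
      rw [ENNReal.ofReal_div_of_pos this]
      simp
    · simp [hk]
  by_cases hqS : q ∈ S
  · exact ⟨{q}, 1, by simpa using hqS, fun x _ => by simpa using hε.le⟩
  have hsummable' : ¬ Summable (fun k : ℕ =>
      (S ∩ Set.Ioi q).indicator (fun k : ℕ => (1 : ℝ) / k) k) := by
    intro h
    apply hsummable
    rw [← summable_nat_add_iff (q + 1)] at h ⊢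
    refine h.congr fun k => ?_
    by_cases hk : k + (q + 1) ∈ S
    · rw [Set.indicator_of_mem hk, Set.indicator_of_mem (show k + (q + 1) ∈ S ∩ Set.Ioi q from
        ⟨hk, Set.mem_Ioi.2 (by omega)⟩)]
    · rw [Set.indicator_of_notMem hk, Set.indicator_of_notMem (fun h => hk h.1)]
  have hnn : ∀ k : ℕ, 0 ≤ (S ∩ Set.Ioi q).indicator (fun k : ℕ => (1 : ℝ) / k) k :=
    fun k => Set.indicator_nonneg (fun _ _ => by positivity) k
  have hlarge : ∃ s : Finset ℕ, (s : Set ℕ) ⊆ S ∩ Set.Ioi q ∧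
      -Real.log ε ≤ ∑ k ∈ s, (1 : ℝ) / k := by
    classical
    by_contra! hcon
    refine hsummable' (summable_of_sum_le (c := -Real.log ε) hnn fun u => ?_)
    rw [show ∑ k ∈ u, (S ∩ Set.Ioi q).indicator (fun k : ℕ => (1 : ℝ) / k) k
        = ∑ k ∈ u with k ∈ S ∩ Set.Ioi q, (1 : ℝ) / k from
      Finset.sum_indicator_eq_sum_filter u (fun _ (k : ℕ) => (1 : ℝ) / k)
        (fun _ => S ∩ Set.Ioi q) id]
    refine (hcon _ fun k hk => ?_).le
    exact (Finset.mem_filter.1 (Finset.mem_coe.1 hk)).2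
  obtain ⟨s, hsS, hsum⟩ := hlarge
  obtain ⟨a, ha⟩ := exists_monomial_approx hq s (fun k hk => hS k (hsS hk).1)
    (fun h => hqS (hsS h).1)
  refine ⟨s, fun k => -a k, fun k hk => (hsS hk).1, fun x hx => ?_⟩
  have hq1 : (1 : ℝ) ≤ q := by exact_mod_cast hq
  calc |x ^ q - ∑ k ∈ s, -a k * x ^ k| = |x ^ q + ∑ k ∈ s, a k * x ^ k| := by
        simp [Finset.sum_neg_distrib]
    _ ≤ ∏ k ∈ s, |1 - (q : ℝ) / k| := ha x hx
    _ ≤ ∏ k ∈ s, Real.exp (-(1 / k)) := by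
        refine Finset.prod_le_prod (fun _ _ => abs_nonneg _) fun k hk => ?_
        have hqk : (q : ℝ) < k := by exact_mod_cast (hsS hk).2
        have hk0 : (0 : ℝ) < k := by linarith
        have h1 : (q : ℝ) / k ≤ 1 := (div_le_one hk0).2 hqk.le
        rw [abs_of_nonneg (by linarith)]
        have h2 : (1 : ℝ) / k ≤ q / k := by gcongr
        have := Real.add_one_le_exp (-(1 / (k : ℝ)))
        linarith
    _ = Real.exp (-∑ k ∈ s, (1 : ℝ) / k) := by rw [← Real.exp_sum, Finset.sum_neg_distrib]
    _ ≤ Real.exp (Real.log ε) := Real.exp_le_exp.2 (by linarith)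
    _ = ε := Real.exp_log hε

theorem integrable_mul_of_continuous {ι : Type*} [Fintype ι] {g : (ι → ℝ) → ℂ} {C : ℝ}
    (hmeas : Measurable g) (hbdd : ∀ t, ‖g t‖ ≤ C) {f : (ι → ℝ) → ℂ} (hf : Continuous f) :
    Integrable (fun t => g t * f t) (volume.restrict (Set.Icc (0 : ι → ℝ) 1)) := by
  have hfi : IntegrableOn f (Set.Icc (0 : ι → ℝ) 1) :=
    hf.continuousOn.integrableOn_compact isCompact_Icc
  exact hfi.bdd_mul hmeas.aestronglyMeasurable (Filter.Eventually.of_forall hbdd)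

theorem integrable_of_bounded {ι : Type*} [Fintype ι] {g : (ι → ℝ) → ℂ} {C : ℝ}
    (hmeas : Measurable g) (hbdd : ∀ t, ‖g t‖ ≤ C) :
    Integrable g (volume.restrict (Set.Icc (0 : ι → ℝ) 1)) := by
  simpa using integrable_mul_of_continuous hmeas hbdd (continuous_const (y := (1 : ℂ)))

theorem continuous_prod_pow {ι : Type*} [Fintype ι] (k : ι → ℕ) :
    Continuous fun t : ι → ℝ => ∏ i, ((t i : ℂ) ^ (k i)) := by
  fun_prop

/-- If the moments of `g` vanish as the `j`-th exponent runs through a set of positive integers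
with divergent sum of reciprocals, they vanish for every positive `j`-th exponent. -/
theorem moment_eq_zero_of_update_mem {ι : Type*} [Fintype ι] [DecidableEq ι]
    {g : (ι → ℝ) → ℂ} {C : ℝ}
    (hmeas : Measurable g) (hbdd : ∀ t, ‖g t‖ ≤ C) (j : ι) (k : ι → ℕ) (hk : 0 < k j)
    {S : Set ℕ} (hS : ∀ m ∈ S, 0 < m)
    (hdiv : ∑' m : S, (1 : ENNReal) / ((m : ℕ) : ENNReal) = ⊤)
    (hzero : ∀ m ∈ S, ∫ t in Set.Icc (0 : ι → ℝ) 1,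
      g t * ∏ i, ((t i : ℂ) ^ (Function.update k j m i)) = 0) :
    ∫ t in Set.Icc (0 : ι → ℝ) 1, g t * ∏ i, ((t i : ℂ) ^ (k i)) = 0 := by
  have hupd : ∀ (t : ι → ℝ) (m : ℕ), ∏ i, ((t i : ℂ) ^ (Function.update k j m i))
      = (t j : ℂ) ^ m * ∏ i ∈ Finset.univ.erase j, ((t i : ℂ) ^ (k i)) := by
    intro t m
    rw [← Finset.mul_prod_erase _ _ (Finset.mem_univ j), Function.update_self]
    congr 1
    refine Finset.prod_congr rfl fun i hi => ?_
    rw [Function.update_of_ne (Finset.ne_of_mem_erase hi)]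
  have hk' : ∀ t : ι → ℝ, ∏ i, ((t i : ℂ) ^ (k i))
      = (t j : ℂ) ^ k j * ∏ i ∈ Finset.univ.erase j, ((t i : ℂ) ^ (k i)) :=
    fun t => (Finset.mul_prod_erase _ _ (Finset.mem_univ j)).symm
  refine integral_mul_eq_zero_of_approx (integrable_of_bounded hmeas hbdd)
    (integrable_mul_of_continuous hmeas hbdd (continuous_prod_pow k)) fun ε hε => ?_
  obtain ⟨s, a, hsS, ha⟩ := exists_muntz_approx hS hdiv hk hε
  have hexp : ∀ t : ι → ℝ,
      g t * ∑ m ∈ s, (a m : ℂ) * ∏ i, ((t i : ℂ) ^ (Function.update k j m i))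
      = ∑ m ∈ s, (a m : ℂ) * (g t * ∏ i, ((t i : ℂ) ^ (Function.update k j m i))) := by
    intro t
    rw [Finset.mul_sum]
    exact Finset.sum_congr rfl fun m _ => by ring
  have hint : ∀ m ∈ s, Integrable
      (fun t => (a m : ℂ) * (g t * ∏ i, ((t i : ℂ) ^ (Function.update k j m i))))
      (volume.restrict (Set.Icc (0 : ι → ℝ) 1)) := fun m _ =>
    (integrable_mul_of_continuous hmeas hbdd (continuous_prod_pow _)).const_mul _
  refine ⟨fun t => ∑ m ∈ s, (a m : ℂ) * ∏ i, ((t i : ℂ) ^ (Function.update k j m i)), ?_, ?_, ?_⟩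
  · simp only [hexp]
    exact integrable_finsetSum s hint
  · simp only [hexp]
    rw [integral_finsetSum s hint]
    refine Finset.sum_eq_zero fun m hm => ?_
    rw [integral_const_mul, hzero m (hsS hm), mul_zero]
  · filter_upwards [ae_restrict_mem measurableSet_Icc] with t ht
    have hfac : ∏ i, ((t i : ℂ) ^ (k i))
          - ∑ m ∈ s, (a m : ℂ) * ∏ i, ((t i : ℂ) ^ (Function.update k j m i))
        = ((t j ^ k j - ∑ m ∈ s, a m * t j ^ m : ℝ) : ℂ)
          * ∏ i ∈ Finset.univ.erase j, ((t i : ℂ) ^ (k i)) := by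
      simp only [hupd, hk']
      push_cast
      rw [sub_mul, Finset.sum_mul]
      simp only [mul_assoc]
    rw [hfac, norm_mul, Complex.norm_real, Real.norm_eq_abs, norm_prod]
    refine (mul_le_of_le_one_right (abs_nonneg _) ?_).trans (ha _ ⟨ht.1 j, ht.2 j⟩)
    refine Finset.prod_le_one (fun _ _ => norm_nonneg _) fun i _ => ?_
    rw [norm_pow, Complex.norm_real, Real.norm_eq_abs]
    exact pow_le_one₀ (abs_nonneg _) 
      ((abs_of_nonneg (ht.1 i)).trans_le (ht.2 i))

theorem ThickAt.nonempty {n : ℕ} {F : Set (Fin n → ℕ)} {j : Fin n} (h : ThickAt F j) :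
    F.Nonempty := by
  by_contra hF
  rw [Set.not_nonempty_iff_eq_empty] at hF
  subst hF
  have : IsEmpty {k : ℕ | 0 < k ∧ ∃ x ∈ (∅ : Set (Fin n → ℕ)), x j = k} :=
    ⟨fun ⟨_, _, _, hx, _⟩ => hx⟩
  rw [ThickAt, tsum_empty] at h
  exact ENNReal.zero_ne_top h

/-- A bounded function on the unit cube with vanishing moments vanishes almost everywhere. -/
theorem ae_eq_zero_of_forall_moment_eq_zero {ι : Type*} [Fintype ι] {h : (ι → ℝ) → ℂ} {C : ℝ}
    (hmeas : Measurable h) (hbdd : ∀ t, ‖h t‖ ≤ C)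
    (hzero : ∀ k : ι → ℕ, ∫ t in Set.Icc (0 : ι → ℝ) 1, h t * ∏ i, ((t i : ℂ) ^ (k i)) = 0) :
    ∀ᵐ t ∂(volume.restrict (Set.Icc (0 : ι → ℝ) 1)), h t = 0 := by
  refine ae_eq_zero_of_integral_contDiff_smul_eq_zero
    (integrable_of_bounded hmeas hbdd).locallyIntegrable fun φ hφ _ => ?_
  have hφc : Continuous φ := hφ.continuous
  have hcomm : ∀ t, φ t • h t = h t * (φ t : ℂ) := fun t => by
    rw [Complex.real_smul, mul_comm]
  simp only [hcomm]
  refine integral_mul_eq_zero_of_approx (integrable_of_bounded hmeas hbdd)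
    (integrable_mul_of_continuous hmeas hbdd (Complex.continuous_ofReal.comp hφc))
    fun ε hε => ?_
  let K : Set (ι → ℝ) := Set.Icc 0 1
  have : CompactSpace K := isCompact_iff_compactSpace.1 isCompact_Icc
  let X : ι → C(K, ℝ) := fun i => ⟨fun t => t.1 i, (continuous_apply i).comp continuous_subtype_val⟩
  have hsep : (MvPolynomial.aeval (R := ℝ) X).range.SeparatesPoints := by
    intro x y hxy
    obtain ⟨i, hi⟩ := Function.ne_iff.1 (fun h => hxy (Subtype.ext h))
    exact ⟨X i, ⟨X i, ⟨MvPolynomial.X i, by simp⟩, rfl⟩, hi⟩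
  obtain ⟨⟨_, p, rfl⟩, hp⟩ :=
    ContinuousMap.exists_mem_subalgebra_near_continuousMap_of_separatesPoints _ hsep
      (⟨fun t => φ t.1, by fun_prop⟩ : C(K, ℝ)) ε hε
  have heval : ∀ t : K, (MvPolynomial.aeval X p : C(K, ℝ)) t = MvPolynomial.eval t.1 p := by
    intro t
    rw [MvPolynomial.aeval_def, MvPolynomial.eval₂_eq', MvPolynomial.eval_eq']
    simp [X, ContinuousMap.sum_apply, ContinuousMap.prod_apply]
  have hexp : ∀ t : ι → ℝ, h t * ((MvPolynomial.eval t p : ℝ) : ℂ)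
      = ∑ d ∈ p.support, ((p.coeff d : ℝ) : ℂ) * (h t * ∏ i, ((t i : ℂ) ^ (d i))) := by
    intro t
    rw [MvPolynomial.eval_eq']
    push_cast
    rw [Finset.mul_sum]
    exact Finset.sum_congr rfl fun m _ => by ring
  have hint : ∀ d ∈ p.support, Integrable
      (fun t => ((p.coeff d : ℝ) : ℂ) * (h t * ∏ i, ((t i : ℂ) ^ (d i))))
      (volume.restrict (Set.Icc (0 : ι → ℝ) 1)) := fun d _ =>
    (integrable_mul_of_continuous hmeas hbdd (continuous_prod_pow _)).const_mul _
  refine ⟨fun t => ((MvPolynomial.eval t p : ℝ) : ℂ), ?_, ?_, ?_⟩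
  · simp only [hexp]
    exact integrable_finsetSum _ hint
  · simp only [hexp]
    rw [integral_finsetSum _ hint]
    refine Finset.sum_eq_zero fun d _ => ?_
    rw [integral_const_mul, hzero d, mul_zero]
  · filter_upwards [ae_restrict_mem measurableSet_Icc] with t ht
    have h1 := (ContinuousMap.norm_coe_le_norm _ (⟨t, ht⟩ : K)).trans hp.le
    rw [← Complex.ofReal_sub, Complex.norm_real, norm_sub_rev, ← heval ⟨t, ht⟩]
    exact h1

theorem CondI.moment_eq_zero {n : ℕ} [NeZero n] {g : (Fin n → ℝ) → ℂ} {C : ℝ}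
    (hmeas : Measurable g) (hbdd : ∀ t, ‖g t‖ ≤ C)
    (hZ : CondI {k : Fin n → ℕ | (∀ i, 0 < k i) ∧
      ∫ t in Set.Icc (0 : Fin n → ℝ) 1, g t * ∏ i, ((t i : ℂ) ^ (k i)) = 0})
    (k : Fin n → ℕ) (hk : ∀ i, 0 < k i) :
    ∫ t in Set.Icc (0 : Fin n → ℝ) 1, g t * ∏ i, ((t i : ℂ) ^ (k i)) = 0 := by
  obtain ⟨E, hEZ, -, h0, hE⟩ := hZ
  have hthick : ∀ (j : Fin n), ∀ x ∈ E, ThickAt (fiberSet E j x) j := by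
    intro j x hx
    rcases (Fin.zero_le j).eq_or_lt with rfl | hj
    · have : fiberSet E 0 x = E := by
        ext y
        simp [fiberSet]
      rwa [this]
    · exact hE j hj x ⟨x, hx, fun _ _ => rfl⟩
  have main : ∀ m ≤ n, ∀ x ∈ E, ∀ k : Fin n → ℕ, (∀ i, 0 < k i) →
      (∀ i : Fin n, (i : ℕ) < m → k i = x i) →
      ∫ t in Set.Icc (0 : Fin n → ℝ) 1, g t * ∏ i, ((t i : ℂ) ^ (k i)) = 0 := by
    intro m hm
    induction hm using Nat.decreasingInduction with
    | self =>
      intro x hx k _ hkx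
      obtain rfl : k = x := funext fun i => hkx i i.2
      exact (hEZ hx).2
    | of_succ m hm ih =>
      intro x hx k hk hkx
      refine moment_eq_zero_of_update_mem hmeas hbdd ⟨m, hm⟩ k (hk _) (fun _ h => h.1)
        (hthick ⟨m, hm⟩ x hx) ?_
      rintro l ⟨hl, y, ⟨hyE, hyx⟩, rfl⟩
      refine ih y hyE _ (fun i => ?_) fun i hi => ?_
      · rcases eq_or_ne i ⟨m, hm⟩ with rfl | hne
        · rwa [Function.update_self]
        · rw [Function.update_of_ne hne]
          exact hk i
      · rcases eq_or_ne i ⟨m, hm⟩ with rfl | hne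
        · rw [Function.update_self]
        · have him : (i : ℕ) < m := by
            have : (i : ℕ) ≠ m := fun h => hne (Fin.ext h)
            omega
          rw [Function.update_of_ne hne, hkx i him, hyx i him]
  obtain ⟨x, hx⟩ := h0.nonempty
  exact main 0 (Nat.zero_le n) x hx k hk (by simp)

/-- If the set of positive multi-indices `k` at which the moment `∫ g(t) tᵏ dt`
vanishes satisfies condition (I), then all such moments vanish and `g = 0` a.e. -/
theorem stmt_9 {n : ℕ} [NeZero n] (g : (Fin n → ℝ) → ℂ) (C : ℝ)
    (hmeas : Measurable g) (hbdd : ∀ t, ‖g t‖ ≤ C)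
    (hZ : CondI {k : Fin n → ℕ | (∀ i, 0 < k i) ∧
      ∫ t in Set.Icc (0 : Fin n → ℝ) 1, g t * ∏ i, ((t i : ℂ) ^ (k i)) = 0}) :
    (∀ k : Fin n → ℕ, (∀ i, 0 < k i) →
        ∫ t in Set.Icc (0 : Fin n → ℝ) 1, g t * ∏ i, ((t i : ℂ) ^ (k i)) = 0) ∧
      ∀ᵐ t ∂(volume.restrict (Set.Icc (0 : Fin n → ℝ) 1)), g t = 0 := by
  have hmom := hZ.moment_eq_zero hmeas hbdd
  refine ⟨hmom, ?_⟩
  let cut : ℝ → ℝ := fun x => max 0 (min x 1)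
  have hcut : ∀ t ∈ Set.Icc (0 : Fin n → ℝ) 1, ∀ i, cut (t i) = t i := fun t ht i => by
    have h0 : 0 ≤ t i := ht.1 i
    have h1 : t i ≤ 1 := ht.2 i
    simp [cut, h0, h1]
  have hh : ∀ᵐ t ∂(volume.restrict (Set.Icc (0 : Fin n → ℝ) 1)),
      g t * ∏ i, (cut (t i) : ℂ) = 0 := by
    refine ae_eq_zero_of_forall_moment_eq_zero (C := C) ?_ (fun t => ?_) fun k => ?_
    · exact hmeas.mul (Continuous.measurable (by fun_prop))
    · rw [norm_mul, norm_prod]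
      refine (mul_le_of_le_one_right (norm_nonneg _) ?_).trans (hbdd t)
      refine Finset.prod_le_one (fun _ _ => norm_nonneg _) fun i _ => ?_
      rw [Complex.norm_real, Real.norm_of_nonneg (le_max_left _ _)]
      exact max_le zero_le_one (min_le_right _ _)
    · rw [← hmom (fun i => k i + 1) fun i => Nat.succ_pos _]
      refine setIntegral_congr_fun measurableSet_Icc fun t ht => ?_
      simp only [hcut t ht, mul_assoc, ← Finset.prod_mul_distrib, pow_succ']
  have hne : ∀ᵐ t ∂(volume.restrict (Set.Icc (0 : Fin n → ℝ) 1)), ∀ i, t i ≠ 0 :=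
    ae_restrict_of_ae (ae_all_iff.2 fun i => Measure.ae_eval_ne (fun _ => volume) i 0)
  filter_upwards [hh, hne, ae_restrict_mem measurableSet_Icc] with t ht htne htI
  refine (mul_eq_zero.1 ht).resolve_right (Finset.prod_ne_zero_iff.2 fun i _ => ?_)
  rw [hcut t htI i]
  exact Complex.ofReal_ne_zero.2 (htne i)
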